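/- Let G be a graph. Then the following hold. (i) If G is 2-edge-connected and C is a cycle of G, then G/C is either a single-vertex graph or is 2-edge-connected. (ii) If G is not 2-edge-connected and C is a cycle of G, then G/C is not 2-edge-connected. (iii) If G is 2-edge-connected, then the single-vertex graph K_1 is a cc-minor of G (obtained by contracting all edges of G via a sequence of cycle contractions). (iv) If |V(G)| ≥ 2 and K_1 is a cc-minor of G, then G is 2-edge-connected. -/

import Mathlib

open scoped Classical

noncomputable section

/-- A finite multigraph with vertices and edge names drawn from `ℕ`.
Each edge name `e ∈ E` has a pair of (possibly equal) endpoints `ends e`. -/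
structure MGraph where
  V : Finset ℕ
  E : Finset ℕ
  ends : ℕ → Sym2 ℕ
  ends_mem : ∀ e ∈ E, ∀ v ∈ ends e, v ∈ V

namespace MGraph

/-- Adjacency via some edge. -/
def Adj (G : MGraph) (u v : ℕ) : Prop := ∃ e ∈ G.E, G.ends e = s(u, v)

/-- Reachability. -/
def Reach (G : MGraph) : ℕ → ℕ → Prop := Relation.ReflTransGen G.Adj

/-- A graph is connected if it has a vertex and all vertices are mutually reachable. -/
def Connected (G : MGraph) : Prop :=
  G.V.Nonempty ∧ ∀ u ∈ G.V, ∀ v ∈ G.V, G.Reach u v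

/-- Delete a set of edges. -/
def deleteEdges (G : MGraph) (Z : Finset ℕ) : MGraph where
  V := G.V
  E := G.E \ Z
  ends := G.ends
  ends_mem := fun e he => G.ends_mem e (Finset.mem_sdiff.mp he).1

/-- A graph with at least two vertices is `k`-edge-connected if deleting any
set of fewer than `k` edges leaves it connected. -/
def EdgeConnected (G : MGraph) (k : ℕ) : Prop :=
  2 ≤ G.V.card ∧ ∀ Z ⊆ G.E, Z.card < k → (G.deleteEdges Z).Connected

/-- A graph is loopless if no edge has equal endpoints. -/
def Loopless (G : MGraph) : Prop := ∀ e ∈ G.E, ¬ (G.ends e).IsDiag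

/-- The set of vertices met by an edge set. -/
def vertsOf (G : MGraph) (C : Finset ℕ) : Finset ℕ :=
  G.V.filter (fun v => ∃ e ∈ C, v ∈ G.ends e)

/-- Degree of `v` in the edge set `C` (loops counted twice). -/
def degIn (G : MGraph) (C : Finset ℕ) (v : ℕ) : ℕ :=
  ∑ e ∈ C, (if G.ends e = s(v, v) then 2 else if v ∈ G.ends e then 1 else 0)

/-- `C` is the edge set of a cycle of `G`: a nonempty connected edge set in which
every vertex met has degree exactly two (a loop and a pair of parallel edges are cycles). -/
def IsCycleSet (G : MGraph) (C : Finset ℕ) : Prop :=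
  C.Nonempty ∧ C ⊆ G.E ∧
  (∀ v ∈ G.vertsOf C, G.degIn C v = 2) ∧
  ∀ u ∈ G.vertsOf C, ∀ v ∈ G.vertsOf C,
    Relation.ReflTransGen (fun a b => ∃ e ∈ C, G.ends e = s(a, b)) u v

/-- The vertex map identifying all vertices of `U` (within `G.V`) to a single one. -/
def cmapOn (G : MGraph) (U : Finset ℕ) : ℕ → ℕ :=
  fun v => if v ∈ U ∩ G.V then sInf {w : ℕ | w ∈ U ∩ G.V} else v

/-- Contract the vertex set `U` to a single vertex, deleting the edges of `S` and all
newly created loops (edges with both ends in `U` that were not already loops), while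
keeping pre-existing loops not in `S`. -/
def contractOn (G : MGraph) (U S : Finset ℕ) : MGraph where
  V := G.V.image (G.cmapOn U)
  E := G.E.filter (fun e => ¬ (∀ v ∈ G.ends e, v ∈ U) ∨ ((G.ends e).IsDiag ∧ e ∉ S))
  ends := fun e => (G.ends e).map (G.cmapOn U)
  ends_mem := by
    intro e he v hv
    have he' : e ∈ G.E := (Finset.mem_filter.mp he).1
    rw [Sym2.mem_map] at hv
    obtain ⟨w, hw, rfl⟩ := hv
    have hwV : w ∈ G.V := G.ends_mem e he' w hw
    by_cases h : w ∈ U ∩ G.V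
    · have hmem : sInf {x : ℕ | x ∈ U ∩ G.V} ∈ U ∩ G.V := Nat.sInf_mem ⟨w, h⟩
      refine Finset.mem_image.mpr ⟨sInf {x : ℕ | x ∈ U ∩ G.V},
        (Finset.mem_inter.mp hmem).2, ?_⟩
      simp [cmapOn, h, hmem]
    · exact Finset.mem_image.mpr ⟨w, hwV, by simp [cmapOn, h]⟩

/-- Contract a cycle (given by its edge set), deleting all created loops. -/
def contractCycle (G : MGraph) (C : Finset ℕ) : MGraph :=
  G.contractOn (G.vertsOf C) C

/-- `H` is a cycle-contraction minor (cc-minor) of `G`: `H` is obtained from `G` by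
a sequence of cycle contractions (each accompanied by contraction of created loops). -/
def CCMinor (G H : MGraph) : Prop :=
  Relation.ReflTransGen (fun A B => ∃ C, A.IsCycleSet C ∧ B = A.contractCycle C) G H

/-- Walks: a vertex list together with a matching edge list. -/
inductive IsWalk (G : MGraph) : List ℕ → List ℕ → Prop
  | nil {v : ℕ} (hv : v ∈ G.V) : IsWalk G [v] []
  | cons {u v : ℕ} {e : ℕ} {vs es : List ℕ} (he : e ∈ G.E)
      (hends : G.ends e = s(u, v)) (hw : IsWalk G (v :: vs) es) :
      IsWalk G (u :: v :: vs) (e :: es)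

/-- A path from `u` to `v`, given by its vertex list and edge list. -/
def IsPathBetween (G : MGraph) (u v : ℕ) (vs es : List ℕ) : Prop :=
  G.IsWalk vs es ∧ vs.Nodup ∧ vs.head? = some u ∧ vs.getLast? = some v

/-- `G` is `k`-connected: it has at least `k` vertices and any two distinct vertices are
joined by at least `k` pairwise internally disjoint paths. -/
def KConnected (G : MGraph) (k : ℕ) : Prop :=
  k ≤ G.V.card ∧ ∀ u ∈ G.V, ∀ v ∈ G.V, u ≠ v →
    ∃ P : Fin k → List ℕ × List ℕ,
      (∀ i, G.IsPathBetween u v (P i).1 (P i).2) ∧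
      ∀ i j, i ≠ j →
        (∀ x, x ∈ (P i).1 → x ∈ (P j).1 → x = u ∨ x = v) ∧
        (∀ e, e ∈ (P i).2 → e ∉ (P j).2)

/-- A simple graph: no loops and no parallel edges. -/
def Simple (G : MGraph) : Prop :=
  G.Loopless ∧ ∀ e ∈ G.E, ∀ f ∈ G.E, G.ends e = G.ends f → e = f

/-- Graph isomorphism. -/
def Iso (G H : MGraph) : Prop :=
  ∃ φ ψ : ℕ → ℕ, Set.BijOn φ ↑G.V ↑H.V ∧ Set.BijOn ψ ↑G.E ↑H.E ∧
    ∀ e ∈ G.E, H.ends (ψ e) = (G.ends e).map φ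

/-- The bond graph `B n`: two vertices joined by `n` parallel edges. -/
def IsBondGraph (H : MGraph) (n : ℕ) : Prop :=
  ∃ u v : ℕ, u ≠ v ∧ H.V = {u, v} ∧ H.E.card = n ∧ ∀ e ∈ H.E, H.ends e = s(u, v)

end MGraph

namespace MGraph

/-- `F` is a subgraph of `G`. -/
def IsSubgraph (F G : MGraph) : Prop :=
  F.V ⊆ G.V ∧ F.E ⊆ G.E ∧ ∀ e ∈ F.E, F.ends e = G.ends e

end MGraph

namespace MGraph

variable {G : MGraph}

theorem vertsOf_subset (C : Finset ℕ) : G.vertsOf C ⊆ G.V := Finset.filter_subset _ _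

theorem mem_vertsOf {C : Finset ℕ} {e v : ℕ} (hC : C ⊆ G.E) (he : e ∈ C) (hv : v ∈ G.ends e) :
    v ∈ G.vertsOf C :=
  Finset.mem_filter.mpr ⟨G.ends_mem e (hC he) v hv, e, he, hv⟩

theorem adj_symm {u v : ℕ} (h : G.Adj u v) : G.Adj v u := by
  obtain ⟨e, he, h⟩ := h
  exact ⟨e, he, h.trans Sym2.eq_swap⟩

/-- The contribution of an edge to the degree of a vertex. -/
theorem degree_term {e a b : ℕ} (h : G.ends e = s(a, b)) (x : ℕ) :
    (if G.ends e = s(x, x) then 2 else if x ∈ G.ends e then 1 else 0) =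
      (if x = a then 1 else 0) + (if x = b then 1 else 0) := by
  rw [h]
  simp only [Sym2.eq_iff, Sym2.mem_iff]
  grind

theorem degIn_insert {C : Finset ℕ} {e a b : ℕ} (he : e ∉ C) (h : G.ends e = s(a, b)) (x : ℕ) :
    G.degIn (insert e C) x =
      G.degIn C x + ((if x = a then 1 else 0) + (if x = b then 1 else 0)) := by
  unfold degIn
  rw [Finset.sum_insert he, degree_term h, add_comm]

/-- Deleting an edge of a cycle leaves the ends of that edge mutually reachable: otherwise the
handshake lemma fails for the component of one of the ends. -/
theorem IsCycleSet.reach_ends {C : Finset ℕ} (hC : G.IsCycleSet C) {f a b : ℕ} (hf : f ∈ C)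
    (hab : G.ends f = s(a, b)) : (G.deleteEdges {f}).Reach a b := by
  obtain ⟨-, hCE, hdeg, -⟩ := hC
  by_contra hn
  let A := (G.vertsOf C).filter (fun x => (G.deleteEdges {f}).Reach a x)
  have haA : a ∈ A :=
    Finset.mem_filter.mpr ⟨mem_vertsOf hCE hf (by simp [hab]), Relation.ReflTransGen.refl⟩
  have hbA : b ∉ A := fun h => hn (Finset.mem_filter.mp h).2
  have hsum : ∑ v ∈ A, G.degIn C v = A.card * 2 :=
    Finset.sum_const_nat fun v hv => hdeg v (Finset.mem_filter.mp hv).1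
  have hterm : ∀ g x y, G.ends g = s(x, y) →
      (∑ v ∈ A, if G.ends g = s(v, v) then 2 else if v ∈ G.ends g then 1 else 0) =
        (if x ∈ A then 1 else 0) + (if y ∈ A then 1 else 0) := by
    intro g x y hg
    rw [Finset.sum_congr rfl fun v _ => degree_term hg v, Finset.sum_add_distrib]
    simp
  have heven : Even (∑ g ∈ C.erase f,
      ∑ v ∈ A, if G.ends g = s(v, v) then 2 else if v ∈ G.ends g then 1 else 0) := by
    refine Finset.even_sum _ fun g hg => ?_
    obtain ⟨hgf, hgC⟩ := Finset.mem_erase.mp hg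
    obtain ⟨x, y, hxy⟩ : ∃ x y, G.ends g = s(x, y) := by
      induction h : G.ends g with | _ x y => exact ⟨x, y, rfl⟩
    have hadj : (G.deleteEdges {f}).Adj x y :=
      ⟨g, Finset.mem_sdiff.mpr ⟨hCE hgC, by simpa using hgf⟩, hxy⟩
    have hx : x ∈ G.vertsOf C := mem_vertsOf hCE hgC (by simp [hxy])
    have hy : y ∈ G.vertsOf C := mem_vertsOf hCE hgC (by simp [hxy])
    have hiff : x ∈ A ↔ y ∈ A := by
      simp only [A, Finset.mem_filter, hx, hy, true_and]
      exact ⟨fun h => h.tail hadj, fun h => h.tail (adj_symm hadj)⟩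
    rw [hterm g x y hxy]
    by_cases h : y ∈ A <;> simp [hiff, h]
  unfold degIn at hsum
  rw [Finset.sum_comm, ← Finset.add_sum_erase _ _ hf, hterm f a b hab] at hsum
  simp only [haA, hbA, if_true, if_false] at hsum
  obtain ⟨k, hk⟩ := heven
  omega

theorem IsCycleSet.reach_deleteEdges {C : Finset ℕ} (hC : G.IsCycleSet C) {Z : Finset ℕ}
    (hZ : Z.card < 2) {u v : ℕ} (hu : u ∈ G.vertsOf C) (hv : v ∈ G.vertsOf C) :
    (G.deleteEdges Z).Reach u v := by
  refine Relation.ReflTransGen.trans_induction_on (hC.2.2.2 u hu v hv)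
    (fun _ => Relation.ReflTransGen.refl) ?_ (fun _ _ h₁ h₂ => h₁.trans h₂)
  rintro a b ⟨f, hf, hab⟩
  by_cases hfZ : f ∈ Z
  · obtain rfl : Z = {f} :=
      (Finset.eq_of_subset_of_card_le (Finset.singleton_subset_iff.mpr hfZ)
        (by simpa using Nat.le_of_lt_succ hZ)).symm
    exact hC.reach_ends hf hab
  · exact Relation.ReflTransGen.single ⟨f, Finset.mem_sdiff.mpr ⟨hC.2.1 hf, hfZ⟩, hab⟩

theorem cmapOn_eq_of_mem {U : Finset ℕ} (hU : U ⊆ G.V) {u v : ℕ} (hu : u ∈ U) (hv : v ∈ U) :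
    G.cmapOn U u = G.cmapOn U v := by
  simp [cmapOn, hu, hv, hU hu, hU hv]

theorem eq_or_mem_of_cmapOn_eq {U : Finset ℕ} {u v : ℕ} (h : G.cmapOn U u = G.cmapOn U v) :
    u = v ∨ u ∈ U ∧ v ∈ U := by
  have key : ∀ w, w ∈ U ∩ G.V → sInf {w : ℕ | w ∈ U ∩ G.V} ∈ U ∩ G.V :=
    fun w hw => Nat.sInf_mem (s := {w : ℕ | w ∈ U ∩ G.V}) ⟨w, hw⟩
  unfold cmapOn at h
  split_ifs at h with hu hv hv
  · exact Or.inr ⟨(Finset.mem_inter.mp hu).1, (Finset.mem_inter.mp hv).1⟩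
  · exact absurd (h ▸ key u hu) hv
  · exact absurd (h ▸ key v hv) hu
  · exact Or.inl h

/-- The graph stays connected after deleting any set of at most one edge. Together with having at
least two vertices this is 2-edge-connectedness; single-vertex graphs also have this property. -/
def Bridgeless (G : MGraph) : Prop :=
  ∀ Z ⊆ G.E, Z.card < 2 → (G.deleteEdges Z).Connected

theorem bridgeless_of_card_eq_one (h : G.V.card = 1) : G.Bridgeless := by
  intro Z _ _
  obtain ⟨x, hx⟩ := Finset.card_eq_one.mp h
  have hV : (G.deleteEdges Z).V = {x} := hx
  refine ⟨by simp [hV], fun u hu v hv => ?_⟩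
  rw [hV, Finset.mem_singleton] at hu hv
  subst hu hv
  exact Relation.ReflTransGen.refl

theorem Bridgeless.nonempty (h : G.Bridgeless) : G.V.Nonempty :=
  (h ∅ (Finset.empty_subset _) (by simp)).1

theorem Bridgeless.card_eq_one (h : G.Bridgeless) (hE : G.E = ∅) : G.V.card = 1 := by
  obtain ⟨x, hx⟩ := h.nonempty
  refine Finset.card_eq_one.mpr ⟨x, Finset.eq_singleton_iff_unique_mem.mpr ⟨hx, fun y hy => ?_⟩⟩
  rcases ((h ∅ (Finset.empty_subset _) (by simp)).2 x hx y hy).cases_tail with h | ⟨_, _, e, he, _⟩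
  · exact h
  · simp [deleteEdges, hE] at he

theorem Bridgeless.contractCycle (h : G.Bridgeless) (C : Finset ℕ) :
    (G.contractCycle C).Bridgeless := by
  intro Z hZ hcard
  obtain ⟨hne, hreach⟩ := h Z (hZ.trans (Finset.filter_subset _ _)) hcard
  refine ⟨hne.image _, fun u hu v hv => ?_⟩
  obtain ⟨u, huV, rfl⟩ := Finset.mem_image.mp hu
  obtain ⟨v, hvV, rfl⟩ := Finset.mem_image.mp hv
  refine Relation.ReflTransGen.trans_induction_on
    (motive := fun {a b} _ => ((G.contractCycle C).deleteEdges Z).Reach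
      (G.cmapOn (G.vertsOf C) a) (G.cmapOn (G.vertsOf C) b))
    (hreach u huV v hvV) (fun _ => Relation.ReflTransGen.refl) ?_ (fun _ _ h₁ h₂ => h₁.trans h₂)
  rintro a b ⟨e, he, hab⟩
  obtain ⟨heE, heZ⟩ := Finset.mem_sdiff.mp he
  replace hab : G.ends e = s(a, b) := hab
  by_cases hin : ∀ v ∈ G.ends e, v ∈ G.vertsOf C
  · rw [cmapOn_eq_of_mem (vertsOf_subset C) (hin a (by simp [hab])) (hin b (by simp [hab]))]
    exact Relation.ReflTransGen.refl
  · refine Relation.ReflTransGen.single ⟨e, Finset.mem_sdiff.mpr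
      ⟨Finset.mem_filter.mpr ⟨heE, Or.inl hin⟩, heZ⟩, ?_⟩
    change (G.ends e).map _ = _
    rw [hab, Sym2.map_mk]

theorem IsCycleSet.bridgeless_of_contractCycle {C : Finset ℕ} (hC : G.IsCycleSet C)
    (h : (G.contractCycle C).Bridgeless) : G.Bridgeless := by
  intro Z _ hcard
  obtain ⟨hne, hreach⟩ := h (Z ∩ (G.contractCycle C).E) Finset.inter_subset_right
    ((Finset.card_le_card Finset.inter_subset_left).trans_lt hcard)
  refine ⟨Finset.image_nonempty.mp hne, fun u hu v hv => ?_⟩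
  have fiber : ∀ a b, G.cmapOn (G.vertsOf C) a = G.cmapOn (G.vertsOf C) b →
      (G.deleteEdges Z).Reach a b := by
    intro a b hab
    rcases eq_or_mem_of_cmapOn_eq hab with rfl | ⟨ha, hb⟩
    · exact Relation.ReflTransGen.refl
    · exact hC.reach_deleteEdges hcard ha hb
  have lift : ∀ x, ((G.contractCycle C).deleteEdges (Z ∩ (G.contractCycle C).E)).Reach
      (G.cmapOn (G.vertsOf C) u) x →
      ∀ w, G.cmapOn (G.vertsOf C) w = x → (G.deleteEdges Z).Reach u w := by
    intro x hx
    induction hx with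
    | refl => exact fun w hw => fiber u w hw.symm
    | tail _ hadj ih =>
      rintro w rfl
      obtain ⟨e, he, hends⟩ := hadj
      obtain ⟨heE, heZ⟩ := Finset.mem_sdiff.mp he
      replace heZ : e ∉ Z := fun h => heZ (Finset.mem_inter.mpr ⟨h, heE⟩)
      replace hends : (G.ends e).map (G.cmapOn (G.vertsOf C)) = _ := hends
      obtain ⟨a, b, hab⟩ : ∃ a b, G.ends e = s(a, b) := by
        induction h : G.ends e with | _ x y => exact ⟨x, y, rfl⟩
      have hadj : (G.deleteEdges Z).Adj a b :=
        ⟨e, Finset.mem_sdiff.mpr ⟨(Finset.mem_filter.mp heE).1, heZ⟩, hab⟩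
      rw [hab, Sym2.map_mk, Sym2.eq_iff] at hends
      rcases hends with ⟨ha, hb⟩ | ⟨ha, hb⟩
      · exact ((ih a ha).tail hadj).trans (fiber b w hb)
      · exact ((ih b hb).tail (adj_symm hadj)).trans (fiber a w ha)
  exact lift _ (hreach _ (Finset.mem_image_of_mem _ hu) _ (Finset.mem_image_of_mem _ hv)) v rfl

theorem IsCycleSet.card_edges_contractCycle_lt {C : Finset ℕ} (hC : G.IsCycleSet C) :
    (G.contractCycle C).E.card < G.E.card := by
  obtain ⟨⟨e, he⟩, hCE, -⟩ := hC
  refine Finset.card_lt_card (Finset.filter_ssubset.mpr ⟨e, hCE he, ?_⟩)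
  simp only [not_or, not_not, not_and]
  exact ⟨fun v hv => mem_vertsOf hCE he hv, fun _ => he⟩

theorem IsPathBetween.exists_suffix {u v w : ℕ} {vs es : List ℕ}
    (h : G.IsPathBetween u v vs es) (hw : w ∈ vs) :
    ∃ vs' es', G.IsPathBetween w v vs' es' := by
  obtain ⟨hwalk, hnd, hu, hv⟩ := h
  induction hwalk generalizing u with
  | nil hx =>
    obtain rfl := List.mem_singleton.mp hw
    exact ⟨_, _, .nil hx, hnd, rfl, hv⟩
  | cons he hends hwalk ih =>
    rcases List.mem_cons.mp hw with rfl | hw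
    · exact ⟨_, _, .cons he hends hwalk, hnd, rfl, hv⟩
    · exact ih hw (List.nodup_cons.mp hnd).2 rfl (by simpa using hv)

theorem Reach.exists_path {u v : ℕ} (h : G.Reach u v) (hv : v ∈ G.V) :
    ∃ vs es, G.IsPathBetween u v vs es := by
  induction h using Relation.ReflTransGen.head_induction_on with
  | refl => exact ⟨[v], [], .nil hv, by simp, rfl, rfl⟩
  | @head a b hab _ ih =>
    obtain ⟨vs, es, hp⟩ := ih
    by_cases ha : a ∈ vs
    · exact hp.exists_suffix ha
    · obtain ⟨e, he, hends⟩ := hab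
      obtain ⟨hwalk, hnd, hb, hl⟩ := hp
      cases vs with
      | nil => simp at hb
      | cons c vs =>
        obtain rfl : c = b := by simpa using hb
        exact ⟨_, _, .cons he hends hwalk, List.nodup_cons.mpr ⟨ha, hnd⟩, rfl, by simpa using hl⟩

theorem IsWalk.edge_mem {vs es : List ℕ} (h : G.IsWalk vs es) {e : ℕ} (he : e ∈ es) :
    e ∈ G.E := by
  induction h with
  | nil => simp at he
  | cons he' _ _ ih =>
    rcases List.mem_cons.mp he with rfl | he
    · exact he'
    · exact ih he

theorem IsWalk.mem_of_mem_ends {vs es : List ℕ} (h : G.IsWalk vs es) {e x : ℕ} (he : e ∈ es)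
    (hx : x ∈ G.ends e) : x ∈ vs := by
  induction h with
  | nil => simp at he
  | cons he' hends _ ih =>
    rcases List.mem_cons.mp he with rfl | he
    · rw [hends, Sym2.mem_iff] at hx
      rcases hx with rfl | rfl <;> simp
    · exact List.mem_cons_of_mem _ (ih he)

theorem IsPathBetween.degIn_add {u v : ℕ} {vs es : List ℕ} (h : G.IsPathBetween u v vs es)
    (x : ℕ) :
    G.degIn es.toFinset x + ((if x = u then 1 else 0) + (if x = v then 1 else 0)) =
      if x ∈ vs then 2 else 0 := by
  obtain ⟨hwalk, hnd, hu, hv⟩ := h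
  induction hwalk generalizing u with
  | @nil w _ =>
    obtain rfl : w = u := by simpa using hu
    obtain rfl : w = v := by simpa using hv
    by_cases hx : x = w <;> simp [degIn, hx]
  | @cons a b e vs es _ hends hwalk ih =>
    obtain rfl : a = u := by simpa using hu
    obtain ⟨ha, hnd⟩ := List.nodup_cons.mp hnd
    have he : e ∉ es.toFinset := fun he =>
      ha (hwalk.mem_of_mem_ends (List.mem_toFinset.mp he) (by simp [hends]))
    have ih := ih hnd rfl (by simpa using hv)
    rw [List.toFinset_cons, degIn_insert he hends]
    by_cases hx : x = a
    · subst hx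
      simp only [ha, if_false] at ih
      simp
      omega
    · simp only [List.mem_cons (a := x) (b := a), hx, false_or, if_false] at ih ⊢
      omega

theorem IsPathBetween.reach_last {u v : ℕ} {vs es : List ℕ} (h : G.IsPathBetween u v vs es)
    {x : ℕ} (hx : x ∈ vs) :
    Relation.ReflTransGen (fun a b => ∃ e ∈ es, G.ends e = s(a, b)) x v := by
  obtain ⟨hwalk, -, -, hv⟩ := h
  induction hwalk generalizing x with
  | @nil w _ =>
    obtain rfl : w = v := by simpa using hv
    obtain rfl := List.mem_singleton.mp hx
    exact .refl
  | @cons a c e vs es _ hends _ ih =>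
    have ih : ∀ y ∈ c :: vs, Relation.ReflTransGen
        (fun a b => ∃ f ∈ e :: es, G.ends f = s(a, b)) y v := fun y hy =>
      Relation.ReflTransGen.mono (fun a b ⟨f, hf, h⟩ => ⟨f, List.mem_cons_of_mem _ hf, h⟩) y v
        (ih hy (by simpa using hv))
    rcases List.mem_cons.mp hx with rfl | hx
    · exact .head ⟨_, List.mem_cons_self, hends⟩ (ih _ List.mem_cons_self)
    · exact ih _ hx

/-- A path joining the ends of an edge it avoids closes up to a cycle. -/
theorem IsPathBetween.isCycleSet_insert {a b e : ℕ} {vs es : List ℕ}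
    (h : G.IsPathBetween a b vs es) (he : e ∈ G.E) (hes : e ∉ es) (hends : G.ends e = s(a, b)) :
    G.IsCycleSet (insert e es.toFinset) := by
  have hmem : ∀ x ∈ G.vertsOf (insert e es.toFinset), x ∈ vs := by
    intro x hx
    obtain ⟨-, f, hf, hxf⟩ := Finset.mem_filter.mp hx
    rcases Finset.mem_insert.mp hf with rfl | hf
    · rw [hends, Sym2.mem_iff] at hxf
      rcases hxf with rfl | rfl
      · exact List.mem_of_head? h.2.2.1
      · exact List.mem_of_getLast? h.2.2.2
    · exact h.1.mem_of_mem_ends (List.mem_toFinset.mp hf) hxf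
  refine ⟨Finset.insert_nonempty _ _, ?_, fun x hx => ?_, fun x hx y hy => ?_⟩
  · intro f hf
    rcases Finset.mem_insert.mp hf with rfl | hf
    · exact he
    · exact h.1.edge_mem (List.mem_toFinset.mp hf)
  · rw [degIn_insert (by simpa using hes) hends, h.degIn_add, if_pos (hmem x hx)]
  · let R : ℕ → ℕ → Prop := fun a b => ∃ f ∈ insert e es.toFinset, G.ends f = s(a, b)
    have : Std.Symm R := ⟨fun _ _ ⟨f, hf, h⟩ => ⟨f, hf, h.trans Sym2.eq_swap⟩⟩
    have hb : ∀ z ∈ vs, Relation.ReflTransGen R z b := fun z hz =>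
      Relation.ReflTransGen.mono (fun a b ⟨f, hf, h⟩ => ⟨f, by simp [hf], h⟩) z b
        (h.reach_last hz)
    exact (hb x (hmem x hx)).trans
      (Std.Symm.symm (r := Relation.ReflTransGen R) y b (hb y (hmem y hy)))

theorem IsWalk.of_deleteEdges {Z : Finset ℕ} {vs es : List ℕ}
    (h : (G.deleteEdges Z).IsWalk vs es) : G.IsWalk vs es := by
  induction h with
  | nil hv => exact .nil hv
  | cons he hends _ ih => exact .cons (Finset.mem_sdiff.mp he).1 hends ih

theorem Bridgeless.exists_isCycleSet (h : G.Bridgeless) (hE : G.E.Nonempty) :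
    ∃ C, G.IsCycleSet C := by
  obtain ⟨e, he⟩ := hE
  obtain ⟨a, b, hab⟩ : ∃ a b, G.ends e = s(a, b) := by
    induction h : G.ends e with | _ x y => exact ⟨x, y, rfl⟩
  have hb : b ∈ G.V := G.ends_mem e he b (by simp [hab])
  obtain ⟨vs, es, hwalk, hpath⟩ := Reach.exists_path
    ((h {e} (Finset.singleton_subset_iff.mpr he) (by simp)).2 a
      (G.ends_mem e he a (by simp [hab])) b hb) hb
  refine ⟨_, IsPathBetween.isCycleSet_insert ⟨hwalk.of_deleteEdges, hpath⟩ he (fun hes => ?_) hab⟩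
  simpa using (Finset.mem_sdiff.mp (hwalk.edge_mem hes)).2

theorem Bridgeless.exists_ccMinor (G : MGraph) (h : G.Bridgeless) :
    ∃ H, G.CCMinor H ∧ H.V.card = 1 ∧ H.E = ∅ := by
  rcases G.E.eq_empty_or_nonempty with hE | hE
  · exact ⟨G, .refl, h.card_eq_one hE, hE⟩
  · obtain ⟨C, hC⟩ := h.exists_isCycleSet hE
    obtain ⟨H, hH, hK⟩ := Bridgeless.exists_ccMinor (G.contractCycle C) (h.contractCycle C)
    exact ⟨H, .head ⟨C, hC, rfl⟩ hH, hK⟩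
termination_by G.E.card
decreasing_by exact hC.card_edges_contractCycle_lt

theorem CCMinor.bridgeless {H : MGraph} (h : G.CCMinor H) (hH : H.Bridgeless) : G.Bridgeless := by
  induction h using Relation.ReflTransGen.head_induction_on with
  | refl => exact hH
  | head hstep _ ih =>
    obtain ⟨C, hC, rfl⟩ := hstep
    exact hC.bridgeless_of_contractCycle ih

end MGraph

/-- (i) Contracting a cycle of a 2-edge-connected graph gives a single-vertex graph or a
2-edge-connected graph; (ii) contracting a cycle of a non-2-edge-connected graph never gives
a 2-edge-connected graph; (iii) every 2-edge-connected graph has `K₁` as a cc-minor;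
(iv) if `G` has at least two vertices and `K₁` as a cc-minor, then `G` is 2-edge-connected. -/
theorem statement_5 (G : MGraph) :
    (G.EdgeConnected 2 → ∀ C, G.IsCycleSet C →
      (G.contractCycle C).V.card = 1 ∨ (G.contractCycle C).EdgeConnected 2) ∧
    (¬ G.EdgeConnected 2 → ∀ C, G.IsCycleSet C → ¬ (G.contractCycle C).EdgeConnected 2) ∧
    (G.EdgeConnected 2 → ∃ H, G.CCMinor H ∧ H.V.card = 1 ∧ H.E = ∅) ∧
    (2 ≤ G.V.card → (∃ H, G.CCMinor H ∧ H.V.card = 1 ∧ H.E = ∅) → G.EdgeConnected 2) := by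
  refine ⟨fun h C _ => ?_, fun h C hC hK => h ?_, fun h => ?_, ?_⟩
  · have hb : (G.contractCycle C).Bridgeless := MGraph.Bridgeless.contractCycle h.2 C
    have := hb.nonempty.card_pos
    by_cases h1 : (G.contractCycle C).V.card = 1
    · exact Or.inl h1
    · exact Or.inr ⟨by omega, hb⟩
  · exact ⟨hK.1.trans Finset.card_image_le, hC.bridgeless_of_contractCycle hK.2⟩
  · exact MGraph.Bridgeless.exists_ccMinor G h.2
  · rintro hV ⟨H, hH, hcard, -⟩
    exact ⟨hV, hH.bridgeless (MGraph.bridgeless_of_card_eq_one hcard)⟩
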